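/- Let σ be a minimal, non-periodic continuous flow on a nonempty compact metric space Ω and let m be a σ-invariant Borel probability measure on Ω. Then there exists a continuous function a : Ω → ℝ such that: (1) ∫_Ω a dm̃ = 0 for every σ-invariant Borel probability measure m̃ on Ω (equivalently, the Sacker–Sell spectrum of a is {0}); (2) a does not admit a continuous primitive; (3) sup_{t ≤ 0} ∫_0^t a(ω·s) ds < ∞ for m-almost every ω ∈ Ω. In particular the set R_m(Ω) is nonempty. -/

import Mathlib

open MeasureTheory

section Flow

variable {Ω : Type*} [MetricSpace Ω] [MeasurableSpace Ω] [BorelSpace Ω] {σ : ℝ → Ω → Ω}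
  {m : Measure Ω} [IsProbabilityMeasure m]

/-- A compact segment of an injective orbit is null for every invariant probability measure. -/
theorem measure_orbit_segment_eq_zero
    (hσcont : Continuous fun p : ℝ × Ω => σ p.1 p.2)
    (hσ0 : ∀ ω, σ 0 ω = ω) (hσadd : ∀ s t ω, σ (s + t) ω = σ s (σ t ω))
    (hminv : ∀ t, Measure.map (σ t) m = m)
    {x : Ω} (hx : Function.Injective fun t : ℝ => σ t x) {T : ℝ} (hT : 0 < T) :
    m ((fun t => σ t x) '' Set.Icc 0 T) = 0 := by
  by_contra h
  have hc : Continuous fun t => σ t x := hσcont.comp (Continuous.prodMk_left x)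
  have hmeas : MeasurableSet ((fun t => σ t x) '' Set.Icc 0 T) :=
    (isCompact_Icc.image hc).isClosed.measurableSet
  have hmp : MeasurePreserving (σ (T + 1)) m m :=
    ⟨(hσcont.comp (Continuous.prodMk_right (T + 1))).measurable, hminv _⟩
  obtain ⟨_, ⟨s, hs, rfl⟩, n, hn, ⟨s', hs', hss'⟩⟩ :=
    hmp.conservative.exists_mem_iterate_mem hmeas.nullMeasurableSet h
  have hiter : ∀ (n : ℕ) (y : Ω), (σ (T + 1))^[n] y = σ (n * (T + 1)) y := by
    intro n
    induction n with
    | zero => simp [hσ0]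
    | succ n ih =>
      intro y
      rw [Function.iterate_succ_apply', ih, ← hσadd]
      push_cast
      congr 1
      ring
  rw [hiter] at hss'
  simp only [← hσadd] at hss'
  have heq : s' = n * (T + 1) + s := hx hss'
  have hn1 : (1 : ℝ) ≤ n := by exact_mod_cast Nat.one_le_iff_ne_zero.mpr hn
  nlinarith [hs.1, hs'.2]

/-- There are continuous functions which are identically one on a given orbit segment and have
arbitrarily small integral. -/
theorem exists_continuous_one_on_orbit_segment
    (hσcont : Continuous fun p : ℝ × Ω => σ p.1 p.2)
    (hσ0 : ∀ ω, σ 0 ω = ω) (hσadd : ∀ s t ω, σ (s + t) ω = σ s (σ t ω))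
    (hminv : ∀ t, Measure.map (σ t) m = m)
    {x : Ω} (hx : Function.Injective fun t : ℝ => σ t x) {T : ℝ} (hT : 0 < T)
    {ε : ENNReal} (hε : 0 < ε) :
    ∃ g : C(Ω, ℝ), (∀ s ∈ Set.Icc 0 T, g (σ s x) = 1) ∧ (∀ ω, g ω ∈ Set.Icc (0 : ℝ) 1) ∧
      ∫⁻ ω, ENNReal.ofReal (g ω) ∂m ≤ ε := by
  have hc : Continuous fun t => σ t x := hσcont.comp (Continuous.prodMk_left x)
  have hK : IsClosed ((fun t => σ t x) '' Set.Icc 0 T) := (isCompact_Icc.image hc).isClosed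
  obtain ⟨U, hKU, hU, hmU⟩ := Set.exists_isOpen_lt_of_lt _ ε
    ((measure_orbit_segment_eq_zero hσcont hσ0 hσadd hminv hx hT).trans_lt hε)
  obtain ⟨g, hg0, hg1, hg⟩ := exists_continuous_zero_one_of_isClosed hU.isClosed_compl hK
    (Set.disjoint_compl_left_iff_subset.mpr hKU)
  refine ⟨g, fun s hs => hg1 ⟨s, hs, rfl⟩, hg, ?_⟩
  calc ∫⁻ ω, ENNReal.ofReal (g ω) ∂m ≤ ∫⁻ ω, U.indicator 1 ω ∂m := by
        refine lintegral_mono fun ω => ?_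
        by_cases hω : ω ∈ U
        · simpa [hω] using (hg ω).2
        · simp [hg0 (show ω ∈ Uᶜ from hω)]
    _ = m U := lintegral_indicator_one hU.measurableSet
    _ ≤ ε := hmU.le

/-- Averaging along the flow yields a nonnegative function `h` of small integral, equal to one at
`x`, which is the transfer function of a uniformly small continuous cocycle `b`. -/
theorem exists_small_coboundary [CompactSpace Ω]
    (hσcont : Continuous fun p : ℝ × Ω => σ p.1 p.2)
    (hσ0 : ∀ ω, σ 0 ω = ω) (hσadd : ∀ s t ω, σ (s + t) ω = σ s (σ t ω))
    (hminv : ∀ t, Measure.map (σ t) m = m)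
    {x : Ω} (hx : Function.Injective fun t : ℝ => σ t x) {δ : ℝ} (hδ : 0 < δ)
    {ε : ENNReal} (hε : 0 < ε) :
    ∃ h b : Ω → ℝ, Continuous h ∧ Continuous b ∧ (∀ ω, 0 ≤ h ω) ∧ h x = 1 ∧
      ∫⁻ ω, ENNReal.ofReal (h ω) ∂m ≤ ε ∧ (∀ ω, |b ω| ≤ δ) ∧
      (∀ ω t, ∫ s in (0 : ℝ)..t, b (σ s ω) = h ω - h (σ t ω)) ∧
      ∀ m' : Measure Ω, IsProbabilityMeasure m' → (∀ t, Measure.map (σ t) m' = m') →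
        ∫ ω, b ω ∂m' = 0 := by
  obtain ⟨g, hg1, hg, hgm⟩ := exists_continuous_one_on_orbit_segment hσcont hσ0 hσadd hminv hx
    (inv_pos.mpr hδ) hε
  have ho : ∀ ω, Continuous fun s => g (σ s ω) := fun ω =>
    g.continuous.comp (hσcont.comp (Continuous.prodMk_left ω))
  have hσt : ∀ t, Continuous (σ t) := fun t => hσcont.comp (Continuous.prodMk_right t)
  have hII : ∀ ω u v, IntervalIntegrable (fun s => g (σ s ω)) volume u v :=
    fun ω u v => (ho ω).intervalIntegrable u v
  refine ⟨fun ω => δ * ∫ s in (0 : ℝ)..δ⁻¹, g (σ s ω), fun ω => δ * (g ω - g (σ δ⁻¹ ω)),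
    ?_, ?_, ?_, ?_, ?_, ?_, ?_, ?_⟩
  · refine continuous_const.mul ?_
    exact intervalIntegral.continuous_parametric_intervalIntegral_of_continuous'
      (f := fun ω s => g (σ s ω)) (g.continuous.comp (hσcont.comp continuous_swap)) 0 δ⁻¹
  · exact continuous_const.mul (g.continuous.sub (g.continuous.comp (hσt _)))
  · exact fun ω => mul_nonneg hδ.le
      (intervalIntegral.integral_nonneg (inv_pos.mpr hδ).le fun s _ => (hg _).1)
  · have : ∫ s in (0 : ℝ)..δ⁻¹, g (σ s x) = ∫ s in (0 : ℝ)..δ⁻¹, (1 : ℝ) := by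
      refine intervalIntegral.integral_congr fun s hs => hg1 s ?_
      rwa [Set.uIcc_of_le (inv_pos.mpr hδ).le] at hs
    simp [this, hδ.ne']
  · have hprod : Measurable fun p : Ω × ℝ => ENNReal.ofReal (g (σ p.2 p.1)) :=
      (ENNReal.continuous_ofReal.comp
        (g.continuous.comp (hσcont.comp continuous_swap))).measurable
    have hpt : ∀ ω, ENNReal.ofReal (δ * ∫ s in (0 : ℝ)..δ⁻¹, g (σ s ω)) =
        ENNReal.ofReal δ * ∫⁻ s in Set.Ioc 0 δ⁻¹, ENNReal.ofReal (g (σ s ω)) := by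
      intro ω
      rw [ENNReal.ofReal_mul hδ.le, intervalIntegral.integral_of_le (inv_pos.mpr hδ).le,
        ofReal_integral_eq_lintegral_ofReal (hII ω 0 δ⁻¹).1
          (Filter.Eventually.of_forall fun s => (hg _).1)]
    simp_rw [hpt]
    rw [lintegral_const_mul _ hprod.lintegral_prod_right',
      lintegral_lintegral_swap hprod.aemeasurable]
    have hinv : ∀ s, ∫⁻ ω, ENNReal.ofReal (g (σ s ω)) ∂m = ∫⁻ ω, ENNReal.ofReal (g ω) ∂m := by
      intro s
      conv_rhs => rw [← hminv s]
      rw [lintegral_map g.continuous.measurable.ennreal_ofReal (hσt s).measurable]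
    simp_rw [hinv]
    rw [lintegral_const, Measure.restrict_apply_univ, Real.volume_Ioc, sub_zero, mul_left_comm,
      ← ENNReal.ofReal_mul hδ.le, mul_inv_cancel₀ hδ.ne', ENNReal.ofReal_one, mul_one]
    exact hgm
  · intro ω
    have h1 := hg ω
    have h2 := hg (σ δ⁻¹ ω)
    rw [abs_mul, abs_of_pos hδ]
    refine mul_le_of_le_one_right hδ.le (abs_le.mpr ⟨?_, ?_⟩) <;> linarith [h1.1, h1.2, h2.1, h2.2]
  · intro ω t
    have hshift : ∀ r u v : ℝ,
        ∫ s in u..v, g (σ s (σ r ω)) = ∫ s in (u + r)..(v + r), g (σ s ω) := by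
      intro r u v
      rw [← intervalIntegral.integral_comp_add_right (fun s => g (σ s ω))]
      simp_rw [hσadd]
    have hcomm : ∀ s : ℝ, σ δ⁻¹ (σ s ω) = σ s (σ δ⁻¹ ω) := fun s => by
      rw [← hσadd, ← hσadd, add_comm]
    simp_rw [hcomm]
    rw [intervalIntegral.integral_const_mul, intervalIntegral.integral_sub (hII ω _ _) (hII _ _ _),
      hshift, hshift, zero_add, zero_add, ← mul_sub]
    congr 1
    rw [sub_eq_sub_iff_add_eq_add, add_comm δ⁻¹,
      intervalIntegral.integral_add_adjacent_intervals (hII _ _ _) (hII _ _ _),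
      intervalIntegral.integral_add_adjacent_intervals (hII _ _ _) (hII _ _ _)]
  · intro m' _ hm'
    have hint : ∀ f : Ω → ℝ, Continuous f → Integrable f m' := fun f hf =>
      hf.integrable_of_hasCompactSupport (HasCompactSupport.of_compactSpace f)
    have hinv : ∫ ω, g (σ δ⁻¹ ω) ∂m' = ∫ ω, g ω ∂m' := by
      conv_rhs => rw [← hm' δ⁻¹]
      rw [integral_map (hσt _).measurable.aemeasurable g.continuous.aestronglyMeasurable]
    rw [integral_const_mul, integral_sub (hint _ g.continuous)
      (hint (fun ω => g (σ δ⁻¹ ω)) (g.continuous.comp (hσt _))), hinv, sub_self, mul_zero]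

end Flow

/-- For a minimal non-periodic continuous flow on a nonempty compact metric
space and a `σ`-invariant Borel probability measure `m`, there exists a continuous
`a : Ω → ℝ` with zero integral with respect to every `σ`-invariant Borel probability
measure, not admitting a continuous primitive, and with `sup_{t ≤ 0} ∫_0^t a(ω·s) ds < ∞`
for `m`-almost every `ω`.  In particular `R_m(Ω)` is nonempty. -/
theorem stmt3 {Ω : Type*} [MetricSpace Ω] [CompactSpace Ω] [Nonempty Ω]
    [MeasurableSpace Ω] [BorelSpace Ω]
    (σ : ℝ → Ω → Ω)
    (hσcont : Continuous fun p : ℝ × Ω => σ p.1 p.2)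
    (hσ0 : ∀ ω, σ 0 ω = ω)
    (hσadd : ∀ s t ω, σ (s + t) ω = σ s (σ t ω))
    (hmin : ∀ ω : Ω, Dense (Set.range fun t => σ t ω))
    (hnp : ∀ ω : Ω, Function.Injective fun t : ℝ => σ t ω)
    (m : Measure Ω) [IsProbabilityMeasure m]
    (hminv : ∀ t, Measure.map (σ t) m = m) :
    ∃ a : Ω → ℝ, Continuous a ∧
      (∀ m' : Measure Ω, IsProbabilityMeasure m' → (∀ t, Measure.map (σ t) m' = m') →
        ∫ ω, a ω ∂m' = 0) ∧
      (¬ ∃ h : Ω → ℝ, Continuous h ∧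
        ∀ ω t, h (σ t ω) - h ω = ∫ s in (0:ℝ)..t, a (σ s ω)) ∧
      (∀ᵐ ω ∂m, ∃ C : ℝ, ∀ t ≤ (0:ℝ), (∫ s in (0:ℝ)..t, a (σ s ω)) ≤ C) := by
  obtain ⟨x⟩ := ‹Nonempty Ω›
  have hpow : ∀ n : ℕ, (0 : ℝ) < (1 / 2) ^ n := fun n => by positivity
  obtain ⟨ε, hε, hεsum⟩ := ENNReal.exists_pos_sum_of_countable' one_ne_zero ℕ
  choose h b hhc hbc hh0 hhx hhm hbδ hcob hbm using fun n : ℕ =>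
    exists_small_coboundary hσcont hσ0 hσadd hminv (hnp x) (hpow n) (hε n)
  have hgeom : Summable fun n : ℕ => ((1 : ℝ) / 2) ^ n := summable_geometric_two
  have hbsum : ∀ ω, HasSum (fun n => b n ω) (∑' n, b n ω) := fun ω =>
    (Summable.of_norm_bounded hgeom fun n => hbδ n ω).hasSum
  have hint : ∀ ω t, HasSum (fun n => h n ω - h n (σ t ω))
      (∫ s in (0 : ℝ)..t, ∑' n, b n (σ s ω)) := by
    intro ω t
    simp_rw [← hcob]
    refine intervalIntegral.hasSum_integral_of_dominated_convergence
      (fun n _ => (1 / 2) ^ n) (fun n => ?_) (fun n => ?_) ?_ ?_ ?_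
    · exact ((hbc n).comp (hσcont.comp (Continuous.prodMk_left ω))).aestronglyMeasurable
    · exact .of_forall fun s _ => hbδ n _
    · exact .of_forall fun s _ => hgeom
    · exact intervalIntegrable_const
    · exact .of_forall fun s _ => hbsum _
  have hfin : ∀ᵐ ω ∂m, Summable fun n => h n ω := by
    have hmeas : ∀ n, Measurable fun ω => ENNReal.ofReal (h n ω) := fun n =>
      (hhc n).measurable.ennreal_ofReal
    have hlt : ∫⁻ ω, ∑' n, ENNReal.ofReal (h n ω) ∂m ≠ ⊤ := by
      rw [lintegral_tsum fun n => (hmeas n).aemeasurable]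
      exact ((ENNReal.tsum_le_tsum hhm).trans_lt (hεsum.trans ENNReal.one_lt_top)).ne
    filter_upwards [ae_lt_top (Measurable.tsum hmeas) hlt] with ω hω
    simpa [ENNReal.toReal_ofReal (hh0 _ ω)] using ENNReal.summable_toReal hω.ne
  refine ⟨fun ω => ∑' n, b n ω, continuous_tsum hbc hgeom fun n ω => hbδ n ω, ?_, ?_, ?_⟩
  · intro m' hm' hinv
    have hs : HasSum (fun n => ∫ ω, b n ω ∂m') (∫ ω, ∑' n, b n ω ∂m') := by
      refine hasSum_integral_of_dominated_convergence (fun n _ => (1 / 2) ^ n)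
        (fun n => (hbc n).aestronglyMeasurable) (fun n => .of_forall fun ω => hbδ n ω)
        (.of_forall fun _ => hgeom) (integrable_const _) (.of_forall hbsum)
    simp_rw [hbm _ m' hm' hinv] at hs
    exact hs.unique hasSum_zero
  · rintro ⟨k, hk, hkb⟩
    obtain ⟨ω, hω⟩ := hfin.exists
    obtain ⟨M, hM⟩ := isCompact_univ.exists_bound_of_continuousOn hk.continuousOn
    have hle : ∀ (N : ℕ) (y : Ω), ∑ n ∈ Finset.range N, h n y ≤ (∑' n, h n ω) + 2 * M := by
      intro N
      have hclosed : IsClosed {y | ∑ n ∈ Finset.range N, h n y ≤ (∑' n, h n ω) + 2 * M} :=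
        isClosed_le (continuous_finsetSum _ fun n _ => hhc n) continuous_const
      have hsub : (Set.range fun t => σ t ω) ⊆
          {y | ∑ n ∈ Finset.range N, h n y ≤ (∑' n, h n ω) + 2 * M} := by
        rintro _ ⟨t, rfl⟩
        have hsum := hω.hasSum.sub (hint ω t)
        simp only [sub_sub_cancel, ← hkb] at hsum
        refine (sum_le_hasSum _ (fun n _ => hh0 n _) hsum).trans ?_
        have h1 := abs_le.mp (hM ω trivial)
        have h2 := abs_le.mp (hM (σ t ω) trivial)
        linarith [h1.2, h2.1]
      intro y
      exact hclosed.closure_subset_iff.mpr hsub ((hmin ω).closure_eq ▸ Set.mem_univ y)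
    obtain ⟨N, hN⟩ := exists_nat_gt ((∑' n, h n ω) + 2 * M)
    have := hle N x
    simp only [hhx, Finset.sum_const, Finset.card_range, nsmul_eq_mul, mul_one] at this
    exact absurd this hN.not_ge
  · filter_upwards [hfin] with ω hω
    exact ⟨∑' n, h n ω, fun t _ => hasSum_le (fun n => sub_le_self _ (hh0 n _)) (hint ω t)
      hω.hasSum⟩
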